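/- arXiv:2002.10814 — 2 statements merged into one kernel-verified Lean document; each statement's English description precedes it below -/
import Mathlib

section
/- Partial failure trace equivalence ≡*_FT is a congruence for the parallel composition operators ∥_S: if P ≡*_FT P' and Q ≡*_FT Q' then P ∥_S Q ≡*_FT P' ∥_S Q', for every S ⊆ A. -/
/-! ### The process algebra CCSP_t

The countably infinite set `A` of visible actions and the countably infinite set `V`
of variables are both taken to be `ℕ`. -/

/-- Actions: visible actions from `A = ℕ`, the hidden action `τ`,
and the time-out action `t`. -/
inductive Act : Type
  | act : ℕ → Act
  | tau : Act
  | timeout : Act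

/-- CCSP_t expressions.  A recursive specification `S` is represented as a partial
function `ℕ → Option Expr`; its domain is the set `V_S` of bound variables, and
`⟨X|S⟩` is written `Expr.fix X S`. -/
inductive Expr : Type
  | nil : Expr
  | pre : Act → Expr → Expr
  | choice : Expr → Expr → Expr
  | par : Set ℕ → Expr → Expr → Expr
  | abs : Set ℕ → Expr → Expr
  | ren : Set (ℕ × ℕ) → Expr → Expr
  | var : ℕ → Expr
  | fix : ℕ → (ℕ → Option Expr) → Expr

/-- `α.notIn S`: the action `α` is not a visible action belonging to `S ⊆ A`. -/
def Act.notIn (α : Act) (S : Set ℕ) : Prop := ∀ a : ℕ, α = Act.act a → a ∉ S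

/-- Relational substitution: `Subst ρ E E'` holds iff `E'` is the result of replacing,
in `E`, every free occurrence of each variable `Y` in the domain of `ρ` by the
expression `ρ Y` (occurrences bound by an inner recursion are not replaced). -/
inductive Subst : (ℕ → Option Expr) → Expr → Expr → Prop
  | nil {ρ} : Subst ρ .nil .nil
  | pre {ρ α E E'} : Subst ρ E E' → Subst ρ (.pre α E) (.pre α E')
  | choice {ρ E F E' F'} : Subst ρ E E' → Subst ρ F F' →
      Subst ρ (.choice E F) (.choice E' F')
  | par {ρ S E F E' F'} : Subst ρ E E' → Subst ρ F F' →
      Subst ρ (.par S E F) (.par S E' F')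
  | abs {ρ I E E'} : Subst ρ E E' → Subst ρ (.abs I E) (.abs I E')
  | ren {ρ R E E'} : Subst ρ E E' → Subst ρ (.ren R E) (.ren R E')
  | varNone {ρ Y} : ρ Y = none → Subst ρ (.var Y) (.var Y)
  | varSome {ρ Y F} : ρ Y = some F → Subst ρ (.var Y) F
  | fix {ρ Z} {T T' : ℕ → Option Expr} :
      (∀ Y, T Y = none ↔ T' Y = none) →
      (∀ Y E E', T Y = some E → T' Y = some E' →
          Subst (fun W => if (T W).isSome then none else ρ W) E E') →
      Subst ρ (.fix Z T) (.fix Z T')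

/-- The substitution replacing each bound variable `Y` of `S` by `⟨Y|S⟩`. -/
def recmap (S : ℕ → Option Expr) : ℕ → Option Expr :=
  fun Y => (S Y).map (fun _ => Expr.fix Y S)

/-- The structural operational (interleaving) semantics of CCSP_t. -/
inductive Step : Expr → Act → Expr → Prop
  | pre {α E} : Step (.pre α E) α E
  | choiceL {E F α E'} : Step E α E' → Step (.choice E F) α E'
  | choiceR {E F α F'} : Step F α F' → Step (.choice E F) α F'
  | renTau {R E E'} : Step E .tau E' → Step (.ren R E) .tau (.ren R E')
  | renTimeout {R E E'} : Step E .timeout E' →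
      Step (.ren R E) .timeout (.ren R E')
  | renAct {R E E' a b} : Step E (.act a) E' → (a, b) ∈ R →
      Step (.ren R E) (.act b) (.ren R E')
  | parL {S E F α E'} : Step E α E' → α.notIn S →
      Step (.par S E F) α (.par S E' F)
  | parR {S E F α F'} : Step F α F' → α.notIn S →
      Step (.par S E F) α (.par S E F')
  | parSync {S E F a E' F'} : Step E (.act a) E' → Step F (.act a) F' → a ∈ S →
      Step (.par S E F) (.act a) (.par S E' F')
  | absFree {I E α E'} : Step E α E' → α.notIn I →
      Step (.abs I E) α (.abs I E')
  | absHide {I E a E'} : Step E (.act a) E' → a ∈ I →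
      Step (.abs I E) .tau (.abs I E')
  | fixUnfold {X S E E' α F} : S X = some E → Subst (recmap S) E E' →
      Step E' α F → Step (.fix X S) α F

/-- Free occurrence of a variable in a CCSP_t expression. -/
inductive Free (x : ℕ) : Expr → Prop
  | pre {α E} : Free x E → Free x (.pre α E)
  | choiceL {E F} : Free x E → Free x (.choice E F)
  | choiceR {E F} : Free x F → Free x (.choice E F)
  | parL {S E F} : Free x E → Free x (.par S E F)
  | parR {S E F} : Free x F → Free x (.par S E F)
  | abs {I E} : Free x E → Free x (.abs I E)
  | ren {R E} : Free x E → Free x (.ren R E)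
  | var : Free x (.var x)
  | fix {Z T Y E} : T Y = some E → Free x E → T x = none → Free x (.fix Z T)

/-- An expression is closed if no variable occurs free in it. -/
def Closed (E : Expr) : Prop := ∀ x, ¬ Free x E

/-- Well-formedness: in every recursion `⟨X|S⟩` occurring in the expression the
variable `X` is bound by `S`, and every relational renaming occurring in it has
finite images `{b | (a,b) ∈ R}`. -/
inductive WF : Expr → Prop
  | nil : WF .nil
  | pre {α E} : WF E → WF (.pre α E)
  | choice {E F} : WF E → WF F → WF (.choice E F)
  | par {S E F} : WF E → WF F → WF (.par S E F)
  | abs {I E} : WF E → WF (.abs I E)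
  | ren {R E} : (∀ a : ℕ, {b | (a, b) ∈ R}.Finite) → WF E → WF (.ren R E)
  | var {X} : WF (.var X)
  | fix {X T} : (T X).isSome → (∀ Y E, T Y = some E → WF E) → WF (.fix X T)

/-- `ℙ`: a process is a closed well-formed CCSP_t expression. -/
def IsProcess (E : Expr) : Prop := Closed E ∧ WF E

/-- A process is stable if it has no outgoing τ-transitions. -/
def stable (P : Expr) : Prop := ¬ ∃ P', Step P .tau P'

/-- The set `I(P)` of initial visible actions of a process. -/
def initials (P : Expr) : Set ℕ := {a | ∃ P', Step P (.act a) P'}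

/-! ### Partial failure traces -/

/-- An element of a partial failure trace: a visible action `a ∈ A`
or a refusal set `X ⊆ A`. -/
abbrev Elt : Type := Sum ℕ (Set ℕ)

/-- Partial failure traces: sequences over `A ∪ 𝒫(A)`; the final tag `⊤` is
left implicit. -/
abbrev PFT : Type := List Elt

/-- The set of partial failure traces of a process (Table 3). -/
inductive fft : Expr → PFT → Prop
  | top {P} : fft P []
  | act {P Q a ρ} : Step P (.act a) Q → fft Q ρ → fft P (Sum.inl a :: ρ)
  | tau {P Q ρ} : Step P .tau Q → fft Q ρ → fft P ρ
  | refusal {P X ρ} : (∀ a ∈ X, a ∉ initials P) → stable P → fft P ρ →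
      fft P (Sum.inr X :: ρ)
  | timeoutRef {P Q X ρ} : (∀ a ∈ X, a ∉ initials P) → stable P →
      Step P .timeout Q → fft Q (Sum.inr X :: ρ) → fft P (Sum.inr X :: ρ)
  | timeoutAct {P Q X a ρ} : (∀ a' ∈ X, a' ∉ initials P) → stable P →
      Step P .timeout Q → fft Q (Sum.inl a :: ρ) → a ∈ X →
      fft P (Sum.inr X :: Sum.inl a :: ρ)

def fftSet (P : Expr) : Set PFT := {σ | fft P σ}

/-! ### Parallel composition, seen from the left component -/

/-- The actions on which the left component of `_ ∥_S Q` must be blocked for the whole to be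
blocked on `X`. -/
def leftEnv (S X : Set ℕ) (Q : Expr) : Set ℕ := {a ∈ X | a ∈ S → a ∈ initials Q}

/-- `ParTrace S Q ρ ν`: any process with the partial failure trace `ρ`, running
in parallel with `Q`, yields the partial failure trace `ν`. -/
inductive ParTrace (S : Set ℕ) : Expr → PFT → PFT → Prop
  | top {Q} : ParTrace S Q [] []
  | tau {Q Q' ρ ν} : Step Q .tau Q' → ParTrace S Q' ρ ν → ParTrace S Q ρ ν
  | actRight {Q Q' a ρ ν} : Step Q (.act a) Q' → a ∉ S → ParTrace S Q' ρ ν →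
      ParTrace S Q ρ (Sum.inl a :: ν)
  | actLeft {Q a ρ ν} : a ∉ S → ParTrace S Q ρ ν →
      ParTrace S Q (Sum.inl a :: ρ) (Sum.inl a :: ν)
  | sync {Q Q' a ρ ν} : Step Q (.act a) Q' → a ∈ S → ParTrace S Q' ρ ν →
      ParTrace S Q (Sum.inl a :: ρ) (Sum.inl a :: ν)
  | refusal {Q X ρ ν} : stable Q → (∀ a ∈ X, a ∉ S → a ∉ initials Q) →
      (∀ a ∈ leftEnv S X Q, ∀ ρ', ρ ≠ Sum.inl a :: ρ') → ParTrace S Q ρ ν →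
      ParTrace S Q (Sum.inr (leftEnv S X Q) :: ρ) (Sum.inr X :: ν)
  | timeoutRef {Q Q' X ρ ν} : stable Q → (∀ a ∈ X, a ∉ S → a ∉ initials Q) →
      (∀ a ∈ leftEnv S X Q, ∀ ρ', ρ ≠ Sum.inl a :: ρ') → Step Q .timeout Q' →
      ParTrace S Q' ρ (Sum.inr X :: ν) →
      ParTrace S Q (Sum.inr (leftEnv S X Q) :: ρ) (Sum.inr X :: ν)
  | timeoutActRight {Q Q' X a ρ ν} : stable Q → (∀ a ∈ X, a ∉ S → a ∉ initials Q) →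
      (∀ a ∈ leftEnv S X Q, ∀ ρ', ρ ≠ Sum.inl a :: ρ') → Step Q .timeout Q' →
      a ∈ X → ParTrace S Q' ρ (Sum.inl a :: ν) →
      ParTrace S Q (Sum.inr (leftEnv S X Q) :: ρ) (Sum.inr X :: Sum.inl a :: ν)
  | timeoutActLeft {Q X a ρ ν} : stable Q → (∀ a ∈ X, a ∉ S → a ∉ initials Q) →
      a ∈ X → ParTrace S Q (Sum.inl a :: ρ) (Sum.inl a :: ν) →
      ParTrace S Q (Sum.inr (leftEnv S X Q) :: Sum.inl a :: ρ)
        (Sum.inr X :: Sum.inl a :: ν)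

theorem Act.tau_notIn (S : Set ℕ) : Act.tau.notIn S := nofun

theorem Act.timeout_notIn (S : Set ℕ) : Act.timeout.notIn S := nofun

theorem Act.act_notIn {S : Set ℕ} {a : ℕ} : (Act.act a).notIn S ↔ a ∉ S :=
  ⟨fun h => h a rfl, fun h b hb => by cases hb; exact h⟩

theorem stable_par {S : Set ℕ} {P Q : Expr} :
    stable (.par S P Q) ↔ stable P ∧ stable Q := by
  constructor
  · exact fun h => ⟨fun ⟨_, hs⟩ => h ⟨_, .parL hs (Act.tau_notIn S)⟩,
      fun ⟨_, hs⟩ => h ⟨_, .parR hs (Act.tau_notIn S)⟩⟩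
  · rintro ⟨hP, hQ⟩ ⟨_, hs⟩
    cases hs with
    | parL hs _ => exact hP ⟨_, hs⟩
    | parR hs _ => exact hQ ⟨_, hs⟩

theorem refuses_par {S X : Set ℕ} {P Q : Expr} :
    (∀ a ∈ X, a ∉ initials (.par S P Q)) ↔
      (∀ a ∈ leftEnv S X Q, a ∉ initials P) ∧ ∀ a ∈ X, a ∉ S → a ∉ initials Q := by
  constructor
  · refine fun h => ⟨fun a ⟨haX, haQ⟩ ⟨_, hs⟩ => h a haX ?_,
      fun a haX haS ⟨_, hs⟩ => h a haX ⟨_, .parR hs (Act.act_notIn.2 haS)⟩⟩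
    by_cases haS : a ∈ S
    · obtain ⟨_, hsQ⟩ := haQ haS
      exact ⟨_, .parSync hs hsQ haS⟩
    · exact ⟨_, .parL hs (Act.act_notIn.2 haS)⟩
  · rintro ⟨hP, hQ⟩ a haX ⟨_, hs⟩
    cases hs with
    | parL hs haS => exact hP a ⟨haX, fun h => absurd h (Act.act_notIn.1 haS)⟩ ⟨_, hs⟩
    | parR hs haS => exact hQ a haX (Act.act_notIn.1 haS) ⟨_, hs⟩
    | parSync hsP hsQ _ => exact hP a ⟨haX, fun _ => ⟨_, hsQ⟩⟩ ⟨_, hsP⟩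

/-- Induction over the derivation of a partial failure trace starting with an action. -/
theorem fft_act_induction {a : ℕ} {ρ : PFT} {motive : Expr → Prop}
    (act : ∀ P Q, Step P (.act a) Q → fft Q ρ → motive P)
    (tau : ∀ P Q, Step P .tau Q → motive Q → motive P)
    {P : Expr} (h : fft P (Sum.inl a :: ρ)) : motive P := by
  generalize hσ : (Sum.inl a :: ρ : PFT) = σ at h
  induction h with
  | act hs h _ => cases hσ; exact act _ _ hs h
  | tau hs _ ih => exact tau _ _ hs (ih hσ)
  | _ => cases hσ

/-- Induction over the derivation of a partial failure trace starting with a refusal set. -/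
theorem fft_refusal_induction {X : Set ℕ} {ρ : PFT} {motive : Expr → Prop}
    (tau : ∀ P Q, Step P .tau Q → motive Q → motive P)
    (refusal : ∀ P, (∀ a ∈ X, a ∉ initials P) → stable P → fft P ρ → motive P)
    (timeoutRef : ∀ P Q, (∀ a ∈ X, a ∉ initials P) → stable P →
      Step P .timeout Q → motive Q → motive P)
    (timeoutAct : ∀ P Q a ρ', (∀ a ∈ X, a ∉ initials P) → stable P →
      Step P .timeout Q → fft Q ρ → a ∈ X → ρ = Sum.inl a :: ρ' → motive P)
    {P : Expr} (h : fft P (Sum.inr X :: ρ)) : motive P := by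
  generalize hσ : (Sum.inr X :: ρ : PFT) = σ at h
  induction h with
  | tau hs _ ih => exact tau _ _ hs (ih hσ)
  | refusal hr hst h _ => cases hσ; exact refusal _ hr hst h
  | timeoutRef hr hst hs _ ih => cases hσ; exact timeoutRef _ _ hr hst hs (ih rfl)
  | timeoutAct hr hst hs h ha _ => cases hσ; exact timeoutAct _ _ _ _ hr hst hs h ha rfl
  | _ => cases hσ

theorem fft_ne_act_of_refuses {X : Set ℕ} {P : Expr} {ρ : PFT}
    (hr : ∀ a ∈ X, a ∉ initials P) (hst : stable P) (h : fft P ρ) :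
    ∀ a ∈ X, ∀ ρ', ρ ≠ Sum.inl a :: ρ' := by
  rintro a ha ρ' rfl
  cases h with
  | act hs _ => exact hr a ha ⟨_, hs⟩
  | tau hs _ => exact hst ⟨_, hs⟩

/-- A refusal of `X` by `P ∥_S Q`, where `P` may first perform time-outs. -/
theorem fft_par_refusal {S X : Set ℕ} {P Q : Expr} {ρ ν : PFT} (hstQ : stable Q)
    (hrQ : ∀ a ∈ X, a ∉ S → a ∉ initials Q)
    (hρ : ∀ a ∈ leftEnv S X Q, ∀ ρ', ρ ≠ Sum.inl a :: ρ')
    (hν : ∀ P, (∀ a ∈ X, a ∉ initials (.par S P Q)) → stable (.par S P Q) →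
      fft P ρ → fft (.par S P Q) (Sum.inr X :: ν))
    (h : fft P (Sum.inr (leftEnv S X Q) :: ρ)) : fft (.par S P Q) (Sum.inr X :: ν) := by
  refine fft_refusal_induction (motive := fun P => fft (.par S P Q) (Sum.inr X :: ν))
    (fun P P' hs ih => .tau (.parL hs (Act.tau_notIn S)) ih)
    (fun P hr hst h => hν P (refuses_par.2 ⟨hr, hrQ⟩) (stable_par.2 ⟨hst, hstQ⟩) h)
    (fun P P' hr hst hs ih => .timeoutRef (refuses_par.2 ⟨hr, hrQ⟩)
      (stable_par.2 ⟨hst, hstQ⟩) (.parL hs (Act.timeout_notIn S)) ih)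
    (fun P P' a ρ' _ _ _ _ ha heq => absurd heq (hρ a ha ρ')) h

theorem ParTrace.fft_par {S : Set ℕ} {Q : Expr} {ρ ν : PFT} (h : ParTrace S Q ρ ν) :
    ∀ {P : Expr}, fft P ρ → fft (.par S P Q) ν := by
  induction h with
  | top => exact fun _ => .top
  | tau hs _ ih => exact fun hP => .tau (.parR hs (Act.tau_notIn S)) (ih hP)
  | actRight hs haS _ ih => exact fun hP => .act (.parR hs (Act.act_notIn.2 haS)) (ih hP)
  | @actLeft Q a ρ ν haS _ ih =>
    exact fft_act_induction (motive := fun P => fft (.par S P Q) (Sum.inl a :: ν))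
      (fun P P' hs h => .act (.parL hs (Act.act_notIn.2 haS)) (ih h))
      (fun P P' hs h => .tau (.parL hs (Act.tau_notIn S)) h)
  | @sync Q Q' a ρ ν hsQ haS _ ih =>
    exact fft_act_induction (motive := fun P => fft (.par S P Q) (Sum.inl a :: ν))
      (fun P P' hs h => .act (.parSync hs hsQ haS) (ih h))
      (fun P P' hs h => .tau (.parL hs (Act.tau_notIn S)) h)
  | refusal hst hr hρ _ ih =>
    exact fft_par_refusal hst hr hρ fun P hr hst h => .refusal hr hst (ih h)
  | timeoutRef hst hr hρ hs _ ih =>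
    exact fft_par_refusal hst hr hρ fun P hr hst h =>
      .timeoutRef hr hst (.parR hs (Act.timeout_notIn S)) (ih h)
  | timeoutActRight hst hr hρ hs ha _ ih =>
    exact fft_par_refusal hst hr hρ fun P hr hst h =>
      .timeoutAct hr hst (.parR hs (Act.timeout_notIn S)) (ih h) ha
  | @timeoutActLeft Q X a ρ ν hstQ hrQ ha _ ih =>
    exact fft_refusal_induction
      (motive := fun P => fft (.par S P Q) (Sum.inr X :: Sum.inl a :: ν))
      (fun P P' hs ih => .tau (.parL hs (Act.tau_notIn S)) ih)
      (fun P hr hst h => .refusal (refuses_par.2 ⟨hr, hrQ⟩) (stable_par.2 ⟨hst, hstQ⟩) (ih h))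
      (fun P P' hr hst hs ih => .timeoutRef (refuses_par.2 ⟨hr, hrQ⟩)
        (stable_par.2 ⟨hst, hstQ⟩) (.parL hs (Act.timeout_notIn S)) ih)
      (fun P P' b ρ' hr hst hs h _ _ => .timeoutAct (refuses_par.2 ⟨hr, hrQ⟩)
        (stable_par.2 ⟨hst, hstQ⟩) (.parL hs (Act.timeout_notIn S)) (ih h) ha)

theorem ParTrace.exists_eq_refusal {S X : Set ℕ} {Q : Expr} {ρ ν : PFT} (hst : stable Q)
    (h : ParTrace S Q ρ (Sum.inr X :: ν)) :
    ∃ ρ', ρ = Sum.inr (leftEnv S X Q) :: ρ' := by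
  cases h with
  | tau hs _ => exact absurd ⟨_, hs⟩ hst
  | _ => exact ⟨_, rfl⟩

theorem ParTrace.exists_eq_act {S X : Set ℕ} {Q : Expr} {a : ℕ} {ρ ν : PFT} (hst : stable Q)
    (hr : ∀ a ∈ X, a ∉ S → a ∉ initials Q) (ha : a ∈ X)
    (h : ParTrace S Q ρ (Sum.inl a :: ν)) :
    a ∈ leftEnv S X Q ∧ ∃ ρ', ρ = Sum.inl a :: ρ' := by
  cases h with
  | tau hs _ => exact absurd ⟨_, hs⟩ hst
  | actRight hs haS _ => exact absurd ⟨_, hs⟩ (hr a ha haS)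
  | actLeft haS _ => exact ⟨⟨ha, fun h => absurd h haS⟩, _, rfl⟩
  | sync hs haS _ => exact ⟨⟨ha, fun _ => ⟨_, hs⟩⟩, _, rfl⟩

theorem exists_parTrace_of_fft_par {S : Set ℕ} {P Q : Expr} {ν : PFT}
    (h : fft (.par S P Q) ν) : ∃ ρ, fft P ρ ∧ ParTrace S Q ρ ν := by
  generalize hE : Expr.par S P Q = E at h
  induction h generalizing P Q with
  | top => exact ⟨[], .top, .top⟩
  | act hs _ ih =>
    subst hE
    cases hs with
    | parL hs haS =>
      obtain ⟨ρ, hρ, hc⟩ := ih rfl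
      exact ⟨_, .act hs hρ, .actLeft (Act.act_notIn.1 haS) hc⟩
    | parR hs haS =>
      obtain ⟨ρ, hρ, hc⟩ := ih rfl
      exact ⟨ρ, hρ, .actRight hs (Act.act_notIn.1 haS) hc⟩
    | parSync hsP hsQ haS =>
      obtain ⟨ρ, hρ, hc⟩ := ih rfl
      exact ⟨_, .act hsP hρ, .sync hsQ haS hc⟩
  | tau hs _ ih =>
    subst hE
    cases hs with
    | parL hs _ =>
      obtain ⟨ρ, hρ, hc⟩ := ih rfl
      exact ⟨ρ, .tau hs hρ, hc⟩
    | parR hs _ =>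
      obtain ⟨ρ, hρ, hc⟩ := ih rfl
      exact ⟨ρ, hρ, .tau hs hc⟩
  | refusal hr hst _ ih =>
    subst hE
    obtain ⟨hrP, hrQ⟩ := refuses_par.1 hr
    obtain ⟨hstP, hstQ⟩ := stable_par.1 hst
    obtain ⟨ρ, hρ, hc⟩ := ih rfl
    exact ⟨_, .refusal hrP hstP hρ,
      .refusal hstQ hrQ (fft_ne_act_of_refuses hrP hstP hρ) hc⟩
  | timeoutRef hr hst hs _ ih =>
    subst hE
    obtain ⟨hrP, hrQ⟩ := refuses_par.1 hr
    obtain ⟨hstP, hstQ⟩ := stable_par.1 hst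
    cases hs with
    | parL hs _ =>
      obtain ⟨ρ, hρ, hc⟩ := ih rfl
      obtain ⟨ρ', rfl⟩ := hc.exists_eq_refusal hstQ
      exact ⟨_, .timeoutRef hrP hstP hs hρ, hc⟩
    | parR hs _ =>
      obtain ⟨ρ, hρ, hc⟩ := ih rfl
      exact ⟨_, .refusal hrP hstP hρ,
        .timeoutRef hstQ hrQ (fft_ne_act_of_refuses hrP hstP hρ) hs hc⟩
  | timeoutAct hr hst hs _ ha ih =>
    subst hE
    obtain ⟨hrP, hrQ⟩ := refuses_par.1 hr
    obtain ⟨hstP, hstQ⟩ := stable_par.1 hst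
    cases hs with
    | parL hs _ =>
      obtain ⟨ρ, hρ, hc⟩ := ih rfl
      obtain ⟨ha', ρ', rfl⟩ := hc.exists_eq_act hstQ hrQ ha
      exact ⟨_, .timeoutAct hrP hstP hs hρ ha', .timeoutActLeft hstQ hrQ ha hc⟩
    | parR hs _ =>
      obtain ⟨ρ, hρ, hc⟩ := ih rfl
      exact ⟨_, .refusal hrP hstP hρ,
        .timeoutActRight hstQ hrQ (fft_ne_act_of_refuses hrP hstP hρ) hs ha hc⟩

theorem fftSet_par_left_congr {S : Set ℕ} {P P' : Expr} (Q : Expr)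
    (h : fftSet P = fftSet P') : fftSet (.par S P Q) = fftSet (.par S P' Q) := by
  have h' : ∀ ρ, fft P ρ ↔ fft P' ρ := Set.ext_iff.1 h
  ext ν
  constructor
  · intro hν
    obtain ⟨ρ, hρ, hc⟩ := exists_parTrace_of_fft_par hν
    exact hc.fft_par ((h' ρ).1 hρ)
  · intro hν
    obtain ⟨ρ, hρ, hc⟩ := exists_parTrace_of_fft_par hν
    exact hc.fft_par ((h' ρ).2 hρ)

theorem Step.par_comm {S : Set ℕ} {P Q E : Expr} {α : Act} (h : Step (.par S P Q) α E) :
    ∃ P' Q', E = .par S P' Q' ∧ Step (.par S Q P) α (.par S Q' P') := by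
  cases h with
  | parL hs hα => exact ⟨_, _, rfl, .parR hs hα⟩
  | parR hs hα => exact ⟨_, _, rfl, .parL hs hα⟩
  | parSync hsP hsQ ha => exact ⟨_, _, rfl, .parSync hsQ hsP ha⟩

theorem initials_par_comm (S : Set ℕ) (P Q : Expr) :
    initials (.par S P Q) = initials (.par S Q P) := by
  ext a
  constructor <;>
  · rintro ⟨_, hs⟩
    obtain ⟨_, _, _, hs'⟩ := hs.par_comm
    exact ⟨_, hs'⟩

theorem fft_par_comm {S : Set ℕ} {P Q : Expr} {ν : PFT} (h : fft (.par S P Q) ν) :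
    fft (.par S Q P) ν := by
  generalize hE : Expr.par S P Q = E at h
  induction h generalizing P Q with
  | top => exact .top
  | act hs _ ih =>
    subst hE
    obtain ⟨_, _, rfl, hs'⟩ := hs.par_comm
    exact .act hs' (ih rfl)
  | tau hs _ ih =>
    subst hE
    obtain ⟨_, _, rfl, hs'⟩ := hs.par_comm
    exact .tau hs' (ih rfl)
  | refusal hr hst _ ih =>
    subst hE
    exact .refusal (initials_par_comm S P Q ▸ hr) (stable_par.2 (stable_par.1 hst).symm) (ih rfl)
  | timeoutRef hr hst hs _ ih =>
    subst hE
    obtain ⟨_, _, rfl, hs'⟩ := hs.par_comm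
    exact .timeoutRef (initials_par_comm S P Q ▸ hr) (stable_par.2 (stable_par.1 hst).symm) hs'
      (ih rfl)
  | timeoutAct hr hst hs _ ha ih =>
    subst hE
    obtain ⟨_, _, rfl, hs'⟩ := hs.par_comm
    exact .timeoutAct (initials_par_comm S P Q ▸ hr) (stable_par.2 (stable_par.1 hst).symm) hs'
      (ih rfl) ha

theorem fftSet_par_comm (S : Set ℕ) (P Q : Expr) :
    fftSet (.par S P Q) = fftSet (.par S Q P) :=
  Set.Subset.antisymm (fun _ => fft_par_comm) (fun _ => fft_par_comm)

/-- Partial failure trace equivalence is a congruence for the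
parallel composition operators `∥_S`. -/
theorem fft_congruence_par (S : Set ℕ) (P P' Q Q' : Expr)
    (hP : IsProcess P) (hP' : IsProcess P') (hQ : IsProcess Q) (hQ' : IsProcess Q')
    (h1 : fftSet P = fftSet P') (h2 : fftSet Q = fftSet Q') :
    fftSet (.par S P Q) = fftSet (.par S P' Q') := by
  rw [fftSet_par_left_congr Q h1, fftSet_par_comm, fftSet_par_left_congr P' h2,
    fftSet_par_comm]
end

section
/- Partial failure trace equivalence ≡*_FT is a congruence for the relational renaming operators: if P ≡*_FT Q then R(P) ≡*_FT R(Q), for every R ⊆ A×A with all sets {b | (a,b) ∈ R} finite. -/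
/-- The set of visible actions that `R` relates to some element of `X`. -/
def renPreimage (R : Set (ℕ × ℕ)) (X : Set ℕ) : Set ℕ := {a | ∃ b ∈ X, (a, b) ∈ R}

/-- `RenTrace R ρ σ`: the trace `ρ` of a process `P` witnesses the trace `σ` of `R(P)`.
Refusal sets are pulled back along `R`. An action following the refusal of `X` may come from
an action in the preimage of `X` only if it belongs to `X` itself. -/
inductive RenTrace (R : Set (ℕ × ℕ)) : PFT → PFT → Prop
  | nil : RenTrace R [] []
  | act {a b ρ σ} : (a, b) ∈ R → RenTrace R ρ σ →
      RenTrace R (Sum.inl a :: ρ) (Sum.inl b :: σ)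
  | refusal {X ρ σ} : RenTrace R ρ σ →
      (∀ a b ρ' σ', ρ = Sum.inl a :: ρ' → σ = Sum.inl b :: σ' → a ∈ renPreimage R X → b ∈ X) →
      RenTrace R (Sum.inr (renPreimage R X) :: ρ) (Sum.inr X :: σ)

theorem stable_ren_iff {R : Set (ℕ × ℕ)} {P : Expr} : stable (.ren R P) ↔ stable P := by
  constructor
  · rintro h ⟨P', hP⟩
    exact h ⟨_, .renTau hP⟩
  · rintro h ⟨P', hP⟩
    cases hP with
    | renTau hP => exact h ⟨_, hP⟩

theorem refuses_ren_iff {R : Set (ℕ × ℕ)} {P : Expr} {X : Set ℕ} :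
    (∀ b ∈ X, b ∉ initials (.ren R P)) ↔ ∀ a ∈ renPreimage R X, a ∉ initials P := by
  constructor
  · rintro h a ⟨b, hb, hab⟩ ⟨P', hP⟩
    exact h b hb ⟨_, .renAct hP hab⟩
  · rintro h b hb ⟨P', hP⟩
    cases hP with
    | renAct hP hab => exact h _ ⟨b, hb, hab⟩ ⟨_, hP⟩

theorem fft.mem_initials {P : Expr} {a : ℕ} {ρ : PFT} (h : fft P (Sum.inl a :: ρ))
    (hs : stable P) : a ∈ initials P := by
  cases h with
  | act hP _ => exact ⟨_, hP⟩
  | tau hP _ => exact absurd ⟨_, hP⟩ hs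

theorem fft.exists_renTrace {R : Set (ℕ × ℕ)} {P : Expr} {σ : PFT} (h : fft (.ren R P) σ) :
    ∃ ρ, RenTrace R ρ σ ∧ fft P ρ := by
  generalize hE : Expr.ren R P = E at h
  induction h generalizing P with
  | top => exact ⟨[], .nil, .top⟩
  | act hP _ ih =>
    subst hE
    cases hP with
    | renAct hP hab =>
      obtain ⟨ρ, hρ, h⟩ := ih rfl
      exact ⟨_, .act hab hρ, .act hP h⟩
  | tau hP _ ih =>
    subst hE
    cases hP with
    | renTau hP =>
      obtain ⟨ρ, hρ, h⟩ := ih rfl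
      exact ⟨ρ, hρ, .tau hP h⟩
  | refusal hX hs _ ih =>
    subst hE
    obtain ⟨ρ, hρ, h⟩ := ih rfl
    rw [refuses_ren_iff] at hX
    rw [stable_ren_iff] at hs
    refine ⟨_, .refusal hρ ?_, .refusal hX hs h⟩
    rintro a b ρ' σ' rfl - ha
    exact absurd (h.mem_initials hs) (hX a ha)
  | timeoutRef hX hs hP _ ih =>
    subst hE
    rw [refuses_ren_iff] at hX
    rw [stable_ren_iff] at hs
    cases hP with
    | renTimeout hP =>
      obtain ⟨ρ, hρ, h⟩ := ih rfl
      cases hρ with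
      | refusal hρ hb => exact ⟨_, .refusal hρ hb, .timeoutRef hX hs hP h⟩
  | timeoutAct hX hs hP _ hb ih =>
    subst hE
    rw [refuses_ren_iff] at hX
    rw [stable_ren_iff] at hs
    cases hP with
    | renTimeout hP =>
      obtain ⟨ρ, hρ, h⟩ := ih rfl
      cases hρ with
      | act hab hρ =>
        refine ⟨_, .refusal (.act hab hρ) ?_, .timeoutAct hX hs hP h ⟨_, hb, hab⟩⟩
        rintro a' b' ρ' σ' - hσ -
        cases hσ
        exact hb

theorem fft.ren {R : Set (ℕ × ℕ)} {P : Expr} {ρ σ : PFT} (h : fft P ρ) (hρ : RenTrace R ρ σ) :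
    fft (.ren R P) σ := by
  induction h generalizing σ with
  | top =>
    cases hρ
    exact .top
  | act hP _ ih =>
    cases hρ with
    | act hab hρ => exact .act (.renAct hP hab) (ih hρ)
  | tau hP _ ih => exact .tau (.renTau hP) (ih hρ)
  | refusal hX hs _ ih =>
    cases hρ with
    | refusal hρ _ => exact .refusal (refuses_ren_iff.2 hX) (stable_ren_iff.2 hs) (ih hρ)
  | timeoutRef hX hs hP _ ih =>
    cases hρ with
    | refusal hρ hb =>
      exact .timeoutRef (refuses_ren_iff.2 hX) (stable_ren_iff.2 hs) (.renTimeout hP)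
        (ih (.refusal hρ hb))
  | timeoutAct hX hs hP _ ha ih =>
    cases hρ with
    | refusal hρ hb =>
      cases hρ with
      | act hab hρ =>
        exact .timeoutAct (refuses_ren_iff.2 hX) (stable_ren_iff.2 hs) (.renTimeout hP)
          (ih (.act hab hρ)) (hb _ _ _ _ rfl rfl ha)

theorem fft_ren_iff {R : Set (ℕ × ℕ)} {P : Expr} {σ : PFT} :
    fft (.ren R P) σ ↔ ∃ ρ, RenTrace R ρ σ ∧ fft P ρ :=
  ⟨fft.exists_renTrace, fun ⟨_, hρ, h⟩ => h.ren hρ⟩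

/-- Partial failure trace equivalence is a congruence for the
relational renaming operators. -/
theorem fft_congruence_ren (R : Set (ℕ × ℕ)) (hR : ∀ a : ℕ, {b | (a, b) ∈ R}.Finite)
    (P Q : Expr) (hP : IsProcess P) (hQ : IsProcess Q) (h : fftSet P = fftSet Q) :
    fftSet (.ren R P) = fftSet (.ren R Q) := by
  ext σ
  have hPQ (ρ : PFT) : fft P ρ ↔ fft Q ρ := Set.ext_iff.1 h ρ
  simp only [fftSet, Set.mem_ofPred_eq, fft_ren_iff, hPQ]
end
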